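/- Let T ⊆ ℝⁿ be a nonempty bounded set, let ℰ₁,…,ℰₙ be i.i.d. symmetric exponential variables (density e^{−|x|}/2), and let d_∞(s,t) = maxᵢ |sᵢ − tᵢ|. Then for every ε > 0: N(T, d_∞, ε·E sup_{t∈T} ∑ᵢ ℰᵢ tᵢ) ≤ e^{4/ε}. -/

import Mathlib

open MeasureTheory ProbabilityTheory Set
open scoped ENNReal BigOperators Pointwise

noncomputable section

namespace Stmt16

/-- the symmetric exponential distribution on `ℝ`, with density `e^{-|x|}/2`. -/
def symExp : Measure ℝ :=
  MeasureTheory.volume.withDensity fun x => ENNReal.ofReal (Real.exp (-|x|) / 2)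

/-- the law of `Eₙ`, a vector of `n` i.i.d. symmetric exponential variables. -/
def expVec (n : ℕ) : Measure (Fin n → ℝ) := Measure.pi fun _ => symExp

/-- the law of a standard Gaussian vector in `ℝⁿ`. -/
def gaussVec (n : ℕ) : Measure (Fin n → ℝ) := Measure.pi fun _ => gaussianReal 0 1

/-- the law of an `n × n` array of i.i.d. standard Gaussian variables. -/
def gaussMat (n : ℕ) : Measure (Fin n × Fin n → ℝ) := Measure.pi fun _ => gaussianReal 0 1

variable {n m : ℕ}

/-- `α_A(y) = √(∑ᵢ (∑_{jk} a_{ijk} y_{jk})²)` for `y ∈ ℝ^{n×m}`. -/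
def alphaA (A : Fin n → Fin n → Fin m → ℝ) (y : Fin n → Fin m → ℝ) : ℝ :=
  Real.sqrt (∑ i, (∑ j, ∑ k, A i j k * y j k) ^ 2)

/-- `α_{∞,A}(y) = maxᵢ |∑_{jk} a_{ijk} y_{jk}|`. -/
def alphaInf (A : Fin n → Fin n → Fin m → ℝ) (y : Fin n → Fin m → ℝ) : ℝ :=
  ⨆ i, |∑ j, ∑ k, A i j k * y j k|

/-- `x ⊗ t = (x_j t_k)_{jk}`. -/
def tens (x : Fin n → ℝ) (t : Fin m → ℝ) : Fin n → Fin m → ℝ := fun j k => x j * t k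

/-- the distance `d_A((x,t),(x',t')) = α_A(x⊗t − x'⊗t')`. -/
def dA (A : Fin n → Fin n → Fin m → ℝ) (z w : (Fin n → ℝ) × (Fin m → ℝ)) : ℝ :=
  alphaA A (tens z.1 z.2 - tens w.1 w.2)

/-- the distance `d_{∞,A}((x,t),(x',t')) = α_{∞,A}(x⊗t − x'⊗t')`. -/
def dInf (A : Fin n → Fin n → Fin m → ℝ) (z w : (Fin n → ℝ) × (Fin m → ℝ)) : ℝ :=
  alphaInf A (tens z.1 z.2 - tens w.1 w.2)

/-- the diameter of `V` in the metric `d_A`. -/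
def diamA (A : Fin n → Fin n → Fin m → ℝ) (V : Set ((Fin n → ℝ) × (Fin m → ℝ))) : ℝ :=
  ⨆ z ∈ V, ⨆ w ∈ V, dA A z w

/-- the diameter of `V` in the metric `d_{∞,A}`. -/
def diamInf (A : Fin n → Fin n → Fin m → ℝ) (V : Set ((Fin n → ℝ) × (Fin m → ℝ))) : ℝ :=
  ⨆ z ∈ V, ⨆ w ∈ V, dInf A z w

/-- `F_A(V) = E sup_{(x,t)∈V} ∑_{ijk} a_{ijk} gᵢ x_j t_k`. -/
def FA (A : Fin n → Fin n → Fin m → ℝ) (V : Set ((Fin n → ℝ) × (Fin m → ℝ))) : ℝ :=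
  ∫ g, (⨆ z ∈ V, ∑ i, ∑ j, ∑ k, A i j k * g i * z.1 j * z.2 k) ∂gaussVec n

/-- `β_{A,T}(x) = E sup_{s∈T} |∑_{ijk} a_{ijk} gᵢ x_j s_k|`. -/
def betaA (A : Fin n → Fin n → Fin m → ℝ) (T : Set (Fin m → ℝ)) (x : Fin n → ℝ) : ℝ :=
  ∫ g, (⨆ s ∈ T, |∑ i, ∑ j, ∑ k, A i j k * g i * x j * s k|) ∂gaussVec n

/-- `s_A(T) = E sup_{t∈T} |∑_{ijk} a_{ijk} g_{ij} t_k| + E sup_{t∈T} |∑_{ijk} a_{ijk} gᵢ ℰⱼ t_k|`. -/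
def sA (A : Fin n → Fin n → Fin m → ℝ) (T : Set (Fin m → ℝ)) : ℝ :=
  (∫ G, (⨆ t ∈ T, |∑ i, ∑ j, ∑ k, A i j k * G (i, j) * t k|) ∂gaussMat n) +
  (∫ w, (⨆ t ∈ T, |∑ i, ∑ j, ∑ k, A i j k * w.1 i * w.2 j * t k|)
      ∂((gaussVec n).prod (expVec n)))

/-- `E α_A(Eₙ ⊗ t)`. -/
def expAlpha (A : Fin n → Fin n → Fin m → ℝ) (t : Fin m → ℝ) : ℝ :=
  ∫ e, alphaA A (tens e t) ∂expVec n

/-- the closed Euclidean unit ball `B₂ⁿ`. -/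
def B2 (n : ℕ) : Set (Fin n → ℝ) := {x | Real.sqrt (∑ i, x i ^ 2) ≤ 1}

/-- the closed `ℓ₁` unit ball `B₁ⁿ`. -/
def B1 (n : ℕ) : Set (Fin n → ℝ) := {x | ∑ i, |x i| ≤ 1}

/-- the Minkowski sum `B₂ⁿ + √p·B₁ⁿ`. -/
def UB (n : ℕ) (p : ℝ) : Set (Fin n → ℝ) := B2 n + Real.sqrt p • B1 n

/-- `s_q(A) = (∑_k (∑_{ij} a_{ijk}²)^{q/2})^{1/q}`. -/
def sq (q : ℝ) (A : Fin n → Fin n → Fin m → ℝ) : ℝ :=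
  (∑ k, (∑ i, ∑ j, A i j k ^ 2) ^ (q / 2)) ^ (1 / q)

/-- `φ_A(x) = (∑_k (∑ᵢ (∑ⱼ a_{ijk} x_j)⁴ / ∑ⱼ a_{ijk}²)^{q/2})^{1/(2q)}`. -/
def phiA (q : ℝ) (A : Fin n → Fin n → Fin m → ℝ) (x : Fin n → ℝ) : ℝ :=
  (∑ k, (∑ i, (∑ j, A i j k * x j) ^ 4 / ∑ j, A i j k ^ 2) ^ (q / 2)) ^ (1 / (2 * q))

/-- `B_{q'} = {t ∈ ℝᵐ : ∑_k |t_k|^{q'} ≤ 1}`. -/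
def Bconj (q' : ℝ) (m : ℕ) : Set (Fin m → ℝ) := {t | ∑ k, |t k| ^ q' ≤ 1}


lemma integrable_exp_neg_mul_abs {c : ℝ} (hc : 0 < c) :
    Integrable fun x : ℝ => Real.exp (-c * |x|) := by
  rw [← integrableOn_univ, ← Iic_union_Ioi (a := (0 : ℝ))]
  refine IntegrableOn.union ?_ ?_
  · refine (integrableOn_exp_mul_Iic hc 0).congr_fun (fun x hx => ?_) measurableSet_Iic
    simp only [abs_of_nonpos (mem_Iic.1 hx)]
    ring_nf
  · refine (integrableOn_exp_mul_Ioi (neg_lt_zero.2 hc) 0).congr_fun (fun x hx => ?_)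
      measurableSet_Ioi
    simp only [abs_of_pos (mem_Ioi.1 hx)]

lemma one_add_abs_mul_exp_neg_abs_le (x : ℝ) :
    (1 + |x|) * Real.exp (-|x|) ≤ 2 * Real.exp (-(1 / 2) * |x|) := by
  have h : Real.exp (-|x|) = Real.exp (-(1 / 2) * |x|) * Real.exp (-(1 / 2) * |x|) := by
    rw [← Real.exp_add]; ring_nf
  have h1 : (1 + |x|) * Real.exp (-(1 / 2) * |x|) ≤ 2 := by
    have h2 := Real.add_one_le_exp ((1 / 2) * |x|)
    calc (1 + |x|) * Real.exp (-(1 / 2) * |x|)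
        ≤ (2 * Real.exp ((1 / 2) * |x|)) * Real.exp (-(1 / 2) * |x|) := by
          gcongr
          linarith [abs_nonneg x]
      _ = 2 := by rw [mul_assoc, ← Real.exp_add]; simp
  rw [h, ← mul_assoc]
  gcongr

lemma integrable_mul_exp_neg_abs {f : ℝ → ℝ} {K : ℝ} (hf : Continuous f)
    (hK : ∀ x, |f x| ≤ K * (1 + |x|)) : Integrable fun x => f x * Real.exp (-|x|) := by
  have hK0 : 0 ≤ K := by
    have := (abs_nonneg _).trans (hK 0)
    simpa using this
  refine ((integrable_exp_neg_mul_abs (c := 1 / 2) (by norm_num)).const_mul (K * 2)).mono'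
    (by fun_prop) (ae_of_all _ fun x => ?_)
  rw [Real.norm_eq_abs, abs_mul, Real.abs_exp]
  calc |f x| * Real.exp (-|x|) ≤ K * ((1 + |x|) * Real.exp (-|x|)) := by
        rw [← mul_assoc]; gcongr; exact hK x
    _ ≤ K * 2 * Real.exp (-(1 / 2) * |x|) := by
        rw [mul_assoc]
        exact mul_le_mul_of_nonneg_left (one_add_abs_mul_exp_neg_abs_le x) hK0

lemma integral_symExp (f : ℝ → ℝ) :
    ∫ x, f x ∂symExp = (∫ x, f x * Real.exp (-|x|)) / 2 := by
  rw [symExp, integral_withDensity_eq_integral_toReal_smul (by fun_prop) (by simp),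
    ← integral_div]
  refine integral_congr_ae (ae_of_all _ fun x => ?_)
  simp only [smul_eq_mul]
  rw [ENNReal.toReal_ofReal (by positivity)]
  ring

lemma integrable_symExp {f : ℝ → ℝ} {K : ℝ} (hf : Continuous f)
    (hK : ∀ x, |f x| ≤ K * (1 + |x|)) : Integrable f symExp := by
  rw [symExp, integrable_withDensity_iff (by fun_prop) (by simp)]
  refine ((integrable_mul_exp_neg_abs hf hK).div_const 2).congr (ae_of_all _ fun x => ?_)
  simp only
  rw [ENNReal.toReal_ofReal (by positivity)]
  ring

lemma integral_Ioi_sub_deriv_two {g g' g'' : ℝ → ℝ} {K : ℝ}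
    (hg : ∀ x, HasDerivAt g (g' x) x) (hg' : ∀ x, HasDerivAt g' (g'' x) x)
    (hc : Continuous g'') (hK : ∀ x, |g x| ≤ K * (1 + |x|)) (hK' : ∀ x, |g' x| ≤ K)
    (hK'' : ∀ x, |g'' x| ≤ K) :
    ∫ x in Ioi 0, (g x - g'' x) * Real.exp (-|x|) = g 0 + g' 0 := by
  have hgc : Continuous g := continuous_iff_continuousAt.2 fun x => (hg x).continuousAt
  have hK0 : 0 ≤ K := (abs_nonneg _).trans (hK' 0)
  have hint : Integrable fun x => (g x - g'' x) * Real.exp (-|x|) := by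
    refine integrable_mul_exp_neg_abs (K := 2 * K) (by fun_prop) fun x => ?_
    have h1 := abs_sub (g x) (g'' x)
    nlinarith [hK x, hK'' x, abs_nonneg x]
  have hlim : Filter.Tendsto (fun x => -(g x + g' x) * Real.exp (-x)) Filter.atTop (nhds 0) := by
    have h2 : Filter.Tendsto (fun x : ℝ => 2 * K * (2 * Real.exp (-(1 / 2 * x))))
        Filter.atTop (nhds 0) := by
      have : Filter.Tendsto (fun x : ℝ => 1 / 2 * x) Filter.atTop Filter.atTop :=
        Filter.tendsto_id.const_mul_atTop (by norm_num)
      simpa using ((Real.tendsto_exp_neg_atTop_nhds_zero.comp this).const_mul 2).const_mul (2 * K)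
    refine squeeze_zero_norm' ?_ h2
    filter_upwards [Filter.eventually_ge_atTop 0] with x hx
    have h3 := one_add_abs_mul_exp_neg_abs_le x
    rw [abs_of_nonneg hx] at h3
    rw [Real.norm_eq_abs, abs_mul, Real.abs_exp, abs_neg]
    have h4 : |g x + g' x| ≤ 2 * K * (1 + x) := by
      have := abs_add_le (g x) (g' x)
      have h5 := hK x
      rw [abs_of_nonneg hx] at h5
      nlinarith [hK' x]
    calc |g x + g' x| * Real.exp (-x) ≤ 2 * K * ((1 + x) * Real.exp (-x)) := by
          rw [← mul_assoc]; gcongr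
      _ ≤ _ := by
          rw [show -(1 / 2 * x) = -(1 / 2) * x by ring]
          gcongr
  have hderiv : ∀ x ∈ Ici (0 : ℝ), HasDerivAt (fun x => -(g x + g' x) * Real.exp (-x))
      ((g x - g'' x) * Real.exp (-|x|)) x := by
    intro x hx
    rw [abs_of_nonneg hx]
    refine (((hg x).fun_add (hg' x)).fun_neg.fun_mul (hasDerivAt_neg x).exp).congr_deriv ?_
    ring
  rw [integral_Ioi_of_hasDerivAt_of_tendsto' hderiv hint.integrableOn hlim]
  simp

/-- The symmetric exponential law is the Green function of `1 - d²/dx²`. -/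
lemma integral_symExp_sub_deriv_two {g g' g'' : ℝ → ℝ} {K : ℝ}
    (hg : ∀ x, HasDerivAt g (g' x) x) (hg' : ∀ x, HasDerivAt g' (g'' x) x)
    (hc : Continuous g'') (hK : ∀ x, |g x| ≤ K * (1 + |x|)) (hK' : ∀ x, |g' x| ≤ K)
    (hK'' : ∀ x, |g'' x| ≤ K) :
    Integrable (fun x => g x - g'' x) symExp ∧ ∫ x, (g x - g'' x) ∂symExp = g 0 := by
  have hgc : Continuous g := continuous_iff_continuousAt.2 fun x => (hg x).continuousAt
  have hK0 : 0 ≤ K := (abs_nonneg _).trans (hK' 0)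
  have hb : ∀ x, |g x - g'' x| ≤ 2 * K * (1 + |x|) := fun x => by
    have h1 := abs_sub (g x) (g'' x)
    nlinarith [hK x, hK'' x, abs_nonneg x]
  have hint := integrable_mul_exp_neg_abs (by fun_prop) hb
  refine ⟨integrable_symExp (by fun_prop) hb, ?_⟩
  have hr := integral_Ioi_sub_deriv_two hg hg' hc hK hK' hK''
  have hl := integral_Ioi_sub_deriv_two (g := fun x => g (-x)) (g' := fun x => -g' (-x))
    (g'' := fun x => g'' (-x)) (K := K)
    (fun x => by
      simpa [Function.comp_def] using (hg (-x)).scomp x (hasDerivAt_neg x))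
    (fun x => by
      simpa [Function.comp_def] using ((hg' (-x)).scomp x (hasDerivAt_neg x)).fun_neg)
    (by fun_prop) (fun x => by simpa using hK (-x)) (fun x => by simpa using hK' (-x))
    (fun x => hK'' (-x))
  have hl' : ∫ x in Iic 0, (g x - g'' x) * Real.exp (-|x|) = g 0 - g' 0 := by
    have := integral_comp_neg_Ioi 0 (fun x => (g x - g'' x) * Real.exp (-|x|))
    simp only [neg_zero, abs_neg] at this hl
    rw [← this, hl]
    ring
  rw [integral_symExp, ← intervalIntegral.integral_Iic_add_Ioi (b := 0) hint.integrableOn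
    hint.integrableOn, hl', hr]
  ring

instance : IsProbabilityMeasure symExp := by
  have h := (integral_symExp_sub_deriv_two (g := fun _ => 1) (g' := fun _ => 0)
    (g'' := fun _ => 0) (K := 1) (fun x => hasDerivAt_const x 1) (fun x => hasDerivAt_const x 0)
    continuous_const (fun x => by simp) (fun x => by simp) (fun x => by simp)).2
  simp only [sub_zero, integral_const, smul_eq_mul, mul_one] at h
  exact ⟨(ENNReal.toReal_eq_one_iff _).1 h⟩

instance (n : ℕ) : IsProbabilityMeasure (expVec n) := by
  unfold expVec; infer_instance

lemma chord_le_log {a b α : ℝ} (ha : 0 < a) (hb : 0 < b) (h0 : 0 ≤ α) (h1 : α ≤ 1) :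
    α * Real.log a + (1 - α) * Real.log b ≤ Real.log (α * a + (1 - α) * b) := by
  simpa using strictConcaveOn_log_Ioi.concaveOn.2 (mem_Ioi.2 ha) (mem_Ioi.2 hb) h0
    (sub_nonneg.2 h1) (by ring)

lemma neg_log_le_of_window_bounds {P V : ℝ} (hP : 0 < P) (hP1 : P ≤ 1)
    (h1 : 8 / 5 * (1 - P) ≤ V) (hk : ∀ k : ℕ, 0 < k → (k : ℝ) ^ 2 * (1 - k * P) ≤ V) :
    -Real.log P ≤ V := by
  have l1 : -1 ≤ Real.log (3 / 8) := by
    rw [Real.le_log_iff_exp_le (by norm_num), Real.exp_neg]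
    exact inv_le_of_inv_le₀ (by norm_num) (by linarith [Real.exp_one_gt_d9])
  have l2 : -3 ≤ Real.log (1 / 20) := by
    rw [Real.le_log_iff_exp_le (by norm_num), Real.exp_neg]
    refine inv_le_of_inv_le₀ (by norm_num) ?_
    have : Real.exp 3 = Real.exp 1 ^ 3 := by rw [← Real.exp_nat_mul]; norm_num
    rw [this]
    calc ((1 : ℝ) / 20)⁻¹ ≤ 2.718 ^ 3 := by norm_num
      _ ≤ _ := by gcongr; linarith [Real.exp_one_gt_d9]
  rcases le_total (3 / 8) P with h | h
  · have := chord_le_log (a := 3 / 8) (b := 1) (α := 8 / 5 * (1 - P)) (by norm_num) one_pos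
      (by linarith) (by linarith)
    rw [Real.log_one, show 8 / 5 * (1 - P) * (3 / 8) + (1 - 8 / 5 * (1 - P)) * 1 = P by ring]
      at this
    nlinarith
  rcases le_total (1 / 20) P with h' | h'
  · have := chord_le_log (a := 1 / 20) (b := 3 / 8) (α := 40 / 13 * (3 / 8 - P)) (by norm_num)
      (by norm_num) (by linarith) (by linarith)
    rw [show 40 / 13 * (3 / 8 - P) * (1 / 20) + (1 - 40 / 13 * (3 / 8 - P)) * (3 / 8) = P by ring]
      at this
    have h2 := hk 2 (by norm_num)
    norm_num at h2
    nlinarith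
  · set y := P⁻¹ with hy
    have hy20 : 20 ≤ y := by
      rw [hy]; exact le_inv_of_le_inv₀ hP (by linarith)
    have hPy : P * y = 1 := mul_inv_cancel₀ hP.ne'
    have hfl := Nat.floor_le (a := y / 2) (by linarith)
    have hfl' := Nat.lt_floor_add_one (y / 2)
    set k := ⌊y / 2⌋₊
    have hk0 : 0 < k := by
      have : (0 : ℝ) < k := by linarith
      exact_mod_cast this
    have hkP : (k : ℝ) * P ≤ 1 / 2 := by nlinarith
    have h3 := hk k hk0
    have h4 : -Real.log P ≤ y - 1 := by
      rw [← Real.log_inv]; exact Real.log_le_sub_one_of_pos (by positivity)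
    have h5 : (y / 2 - 1) ^ 2 ≤ (k : ℝ) ^ 2 := by
      apply pow_le_pow_left₀ <;> linarith
    nlinarith [sq_nonneg (k : ℝ)]

section Window

variable {ι : Type*} (S : Finset ι) (w u : ι → ℝ)

/-- The mass that the weights `w` at the points `u` give to the window `[s, s + 1]`. -/
def windowMass (s : ℝ) : ℝ := ∑ i ∈ S with s ≤ u i ∧ u i ≤ s + 1, w i

lemma windowMass_eq (s : ℝ) :
    windowMass S w u s = ∑ i ∈ S, w i * if s ≤ u i ∧ u i ≤ s + 1 then 1 else 0 := by
  simp [windowMass, Finset.sum_filter]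

lemma exists_windowMass_max : ∃ s₀, ∀ s, windowMass S w u s ≤ windowMass S w u s₀ := by
  classical
  have hfin : (range (windowMass S w u)).Finite := by
    refine ((S.powerset.finite_toSet).image fun A => ∑ i ∈ A, w i).subset ?_
    rintro _ ⟨s, rfl⟩
    exact ⟨_, Finset.mem_coe.2 (Finset.mem_powerset.2 (Finset.filter_subset _ _)), rfl⟩
  obtain ⟨_, ⟨s₀, rfl⟩, h⟩ := exists_max_image _ id hfin (range_nonempty _)
  exact ⟨s₀, fun s => h _ ⟨s, rfl⟩⟩

variable {S w}

lemma le_of_forall_windowMass_le {P : ℝ} (hw : ∀ i, 0 ≤ w i) (hsum : ∑ i ∈ S, w i = 1)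
    (hP : ∀ s, windowMass S w u s ≤ P) (m : ℝ) :
    8 / 5 * (1 - P) ≤ 4 * ∑ i ∈ S, w i * (u i - m) ^ 2 := by
  have key : ∑ i ∈ S, w i * (4 - 10 * (u i - m) ^ 2) ≤
      windowMass S w u (m - 2 / 3) + windowMass S w u (m - 11 / 20) +
      windowMass S w u (m - 9 / 20) + windowMass S w u (m - 1 / 3) := by
    simp only [windowMass_eq, ← Finset.sum_add_distrib, ← mul_add]
    refine Finset.sum_le_sum fun i _ => mul_le_mul_of_nonneg_left ?_ (hw i)
    generalize u i = t
    obtain ⟨y, rfl⟩ : ∃ y, t = m + y := ⟨t - m, by ring⟩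
    have h0 : ∀ a : ℝ, (0 : ℝ) ≤ if m - a ≤ m + y ∧ m + y ≤ m - a + 1 then 1 else 0 :=
      fun a => by split_ifs <;> norm_num
    have h1 : ∀ a : ℝ, -a ≤ y → y ≤ 1 - a →
        (if m - a ≤ m + y ∧ m + y ≤ m - a + 1 then 1 else 0 : ℝ) = 1 :=
      fun a _ _ => if_pos ⟨by linarith, by linarith⟩
    have b1 := h0 (2 / 3)
    have b2 := h0 (11 / 20)
    have b3 := h0 (9 / 20)
    have b4 := h0 (1 / 3)
    rw [add_sub_cancel_left]
    rcases le_total 0 y with hy | hy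
    · rcases le_or_gt y (1 / 3) with c1 | c1
      · rw [h1, h1, h1, h1] <;> nlinarith
      rcases le_or_gt y (9 / 20) with c2 | c2
      · rw [h1 (11 / 20), h1 (9 / 20), h1 (1 / 3)] <;> nlinarith
      rcases le_or_gt y (11 / 20) with c3 | c3
      · rw [h1 (9 / 20), h1 (1 / 3)] <;> nlinarith
      rcases le_or_gt y (2 / 3) with c4 | c4
      · rw [h1 (1 / 3)] <;> nlinarith
      · nlinarith
    · rcases le_or_gt (-(1 / 3)) y with c1 | c1
      · rw [h1, h1, h1, h1] <;> nlinarith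
      rcases le_or_gt (-(9 / 20)) y with c2 | c2
      · rw [h1 (2 / 3), h1 (11 / 20), h1 (9 / 20)] <;> nlinarith
      rcases le_or_gt (-(11 / 20)) y with c3 | c3
      · rw [h1 (2 / 3), h1 (11 / 20)] <;> nlinarith
      rcases le_or_gt (-(2 / 3)) y with c4 | c4
      · rw [h1 (2 / 3)] <;> nlinarith
      · nlinarith
  simp only [mul_sub, Finset.sum_sub_distrib, ← Finset.sum_mul, hsum, mul_left_comm _ (10 : ℝ),
    ← Finset.mul_sum] at key
  linarith [hP (m - 2 / 3), hP (m - 11 / 20), hP (m - 9 / 20), hP (m - 1 / 3)]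

lemma sq_mul_le_of_forall_windowMass_le {P : ℝ} (hw : ∀ i, 0 ≤ w i) (hsum : ∑ i ∈ S, w i = 1)
    (hP : ∀ s, windowMass S w u s ≤ P) (m : ℝ) {k : ℕ} (hk : 0 < k) :
    (k : ℝ) ^ 2 * (1 - k * P) ≤ 4 * ∑ i ∈ S, w i * (u i - m) ^ 2 := by
  have hk' : (1 : ℝ) ≤ k := by exact_mod_cast hk
  have key : ∑ i ∈ S, w i * ((k : ℝ) ^ 2 - 4 * (u i - m) ^ 2) ≤
      (k : ℝ) ^ 2 * ∑ j ∈ Finset.range k, windowMass S w u (m - k / 2 + j) := by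
    simp only [windowMass_eq]
    rw [Finset.sum_comm, Finset.mul_sum]
    refine Finset.sum_le_sum fun i _ => ?_
    rw [← Finset.mul_sum, mul_left_comm]
    refine mul_le_mul_of_nonneg_left ?_ (hw i)
    have hnn : ∀ j ∈ Finset.range k, (0 : ℝ) ≤
        if m - k / 2 + j ≤ u i ∧ u i ≤ m - k / 2 + j + 1 then 1 else 0 := fun j _ => by
      split_ifs <;> norm_num
    by_cases h : |u i - m| ≤ k / 2
    · obtain ⟨h1, h2⟩ := abs_le.1 h
      obtain ⟨j, hj, hj1, hj2⟩ : ∃ j < k, m - k / 2 + j ≤ u i ∧ u i ≤ m - k / 2 + j + 1 := by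
        have hfl := Nat.floor_le (a := u i - m + k / 2) (by linarith)
        have hfl' := Nat.lt_floor_add_one (u i - m + k / 2)
        by_cases hlt : ⌊u i - m + k / 2⌋₊ < k
        · exact ⟨_, hlt, by linarith, by linarith⟩
        · have : (k : ℝ) ≤ ⌊u i - m + k / 2⌋₊ := by exact_mod_cast not_lt.1 hlt
          refine ⟨k - 1, by omega, ?_, ?_⟩ <;> push_cast [Nat.cast_sub hk] <;> linarith
      have h3 := Finset.single_le_sum hnn (Finset.mem_range.2 hj)
      rw [if_pos ⟨hj1, hj2⟩] at h3
      nlinarith [sq_nonneg (u i - m), sq_nonneg (k : ℝ)]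
    · have h3 := Finset.sum_nonneg hnn
      have h4 : (k / 2 : ℝ) ^ 2 ≤ (u i - m) ^ 2 := by
        rw [← sq_abs (u i - m)]
        exact pow_le_pow_left₀ (by positivity) (not_le.1 h).le 2
      have h5 : 0 ≤ (k : ℝ) ^ 2 * ∑ j ∈ Finset.range k,
        (if m - k / 2 + j ≤ u i ∧ u i ≤ m - k / 2 + j + 1 then (1 : ℝ) else 0) := by positivity
      nlinarith
  have h6 : ∑ j ∈ Finset.range k, windowMass S w u (m - k / 2 + j) ≤ k * P := by
    refine (Finset.sum_le_card_nsmul _ _ P fun j _ => hP _).trans ?_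
    simp
  simp only [mul_sub, Finset.sum_sub_distrib, ← Finset.sum_mul, hsum, mul_left_comm _ (4 : ℝ),
    ← Finset.mul_sum] at key
  nlinarith [sq_nonneg (k : ℝ)]

/-- A probability measure on `ℝ` with variance `v` charges some unit window by `e^{-4v}`. -/
lemma exists_exp_neg_le_windowMass (hw : ∀ i, 0 < w i) (hsum : ∑ i ∈ S, w i = 1) (m : ℝ) :
    ∃ s, Real.exp (-(4 * ∑ i ∈ S, w i * (u i - m) ^ 2)) ≤ windowMass S w u s := by
  have hw' : ∀ i, 0 ≤ w i := fun i => (hw i).le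
  obtain ⟨s₀, hs⟩ := exists_windowMass_max S w u
  refine ⟨s₀, ?_⟩
  obtain ⟨i, hi⟩ : S.Nonempty := by
    rw [Finset.nonempty_iff_ne_empty]; rintro rfl; simp at hsum
  have hpos : 0 < windowMass S w u s₀ := by
    refine lt_of_lt_of_le ?_ (hs (u i))
    refine (hw i).trans_le (Finset.single_le_sum (fun j _ => hw' j) ?_)
    simp [hi]
  have h1 : windowMass S w u s₀ ≤ 1 := by
    rw [← hsum]
    exact Finset.sum_le_sum_of_subset_of_nonneg (Finset.filter_subset _ _) fun j _ _ => hw' j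
  have := neg_log_le_of_window_bounds hpos h1 (le_of_forall_windowMass_le u hw' hsum hs m)
    fun k hk => sq_mul_le_of_forall_windowMass_le u hw' hsum hs m hk
  rw [← Real.le_log_iff_exp_le hpos]
  linarith

end Window

/-- One-dimensional estimate: the log-Laplace transform of weights on `ℝ`, corrected by its second
derivative, is dominated by the logarithm of the tilted mass of a unit window. -/
lemma exists_integrable_le_log_window {ι : Type*} {S : Finset ι} (hS : S.Nonempty) {w : ι → ℝ}
    (hw : ∀ i, 0 < w i) (u : ι → ℝ) :
    ∃ D : ℝ → ℝ, Integrable D symExp ∧ ∫ x, D x ∂symExp = Real.log (∑ i ∈ S, w i) ∧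
      ∀ x, ∃ s, (S.filter fun i => s ≤ u i ∧ u i ≤ s + 1).Nonempty ∧
        D x ≤ Real.log (∑ i ∈ S with s ≤ u i ∧ u i ≤ s + 1, w i * Real.exp (2 * u i * x)) := by
  set Z : ℝ → ℝ := fun x => ∑ i ∈ S, w i * Real.exp (2 * u i * x) with hZ
  set Z₁ : ℝ → ℝ := fun x => ∑ i ∈ S, w i * Real.exp (2 * u i * x) * (2 * u i) with hZ₁
  set Z₂ : ℝ → ℝ := fun x => ∑ i ∈ S, w i * Real.exp (2 * u i * x) * (2 * u i) ^ 2 with hZ₂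
  have hwe : ∀ i x, 0 < w i * Real.exp (2 * u i * x) := fun i x =>
    mul_pos (hw i) (Real.exp_pos _)
  have hZpos : ∀ x, 0 < Z x := fun x => Finset.sum_pos (fun i _ => hwe i x) hS
  have dexp : ∀ i x, HasDerivAt (fun x => w i * Real.exp (2 * u i * x))
      (w i * Real.exp (2 * u i * x) * (2 * u i)) x := fun i x => by
    have := (((hasDerivAt_id x).const_mul (2 * u i)).exp).const_mul (w i)
    simpa [mul_assoc] using this
  have dZ : ∀ x, HasDerivAt Z (Z₁ x) x := fun x => HasDerivAt.fun_sum fun i _ => dexp i x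
  have dZ₁ : ∀ x, HasDerivAt Z₁ (Z₂ x) x := fun x => by
    refine (HasDerivAt.fun_sum fun i _ => (dexp i x).mul_const (2 * u i)).congr_deriv ?_
    exact Finset.sum_congr rfl fun i _ => by ring
  set C := ∑ i ∈ S, |2 * u i| with hC
  have hC0 : 0 ≤ C := Finset.sum_nonneg fun i _ => abs_nonneg _
  have huC : ∀ i ∈ S, |2 * u i| ≤ C := fun i hi =>
    Finset.single_le_sum (f := fun i => |2 * u i|) (fun j _ => abs_nonneg _) hi
  have hZ₁b : ∀ x, |Z₁ x / Z x| ≤ C := fun x => by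
    rw [abs_div, abs_of_pos (hZpos x), div_le_iff₀ (hZpos x), hZ, Finset.mul_sum]
    refine (Finset.abs_sum_le_sum_abs _ _).trans (Finset.sum_le_sum fun i hi => ?_)
    rw [abs_mul, abs_of_pos (hwe i x), mul_comm]
    exact mul_le_mul_of_nonneg_right (huC i hi) (hwe i x).le
  have hZ₂b : ∀ x, |Z₂ x / Z x| ≤ C ^ 2 := fun x => by
    rw [abs_div, abs_of_pos (hZpos x), div_le_iff₀ (hZpos x), hZ, Finset.mul_sum]
    refine (Finset.abs_sum_le_sum_abs _ _).trans (Finset.sum_le_sum fun i hi => ?_)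
    rw [abs_mul, abs_of_pos (hwe i x), mul_comm, abs_pow]
    exact mul_le_mul_of_nonneg_right (pow_le_pow_left₀ (abs_nonneg _) (huC i hi) 2) (hwe i x).le
  have dg : ∀ x, HasDerivAt (fun x => Real.log (Z x)) (Z₁ x / Z x) x := fun x =>
    (dZ x).log (hZpos x).ne'
  have dg' : ∀ x, HasDerivAt (fun x => Z₁ x / Z x) (Z₂ x / Z x - (Z₁ x / Z x) ^ 2) x := fun x => by
    refine ((dZ₁ x).fun_div (dZ x) (hZpos x).ne').congr_deriv ?_
    have := (hZpos x).ne'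
    field_simp
  have hcont : Continuous fun x => Z₂ x / Z x - (Z₁ x / Z x) ^ 2 := by
    have h0 : Continuous Z := by fun_prop
    have h1 : Continuous Z₁ := by fun_prop
    have h2 : Continuous Z₂ := by fun_prop
    exact (h2.div h0 fun x => (hZpos x).ne').sub ((h1.div h0 fun x => (hZpos x).ne').pow 2)
  have hgrowth : ∀ x, |Real.log (Z x)| ≤ |Real.log (Z 0)| + C * |x| := fun x => by
    have := convex_univ.norm_image_sub_le_of_norm_hasDerivWithin_le
      (f := fun x => Real.log (Z x)) (C := C) (x := 0) (y := x)
      (fun y _ => (dg y).hasDerivWithinAt) (fun y _ => hZ₁b y) (mem_univ _) (mem_univ _)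
    simp only [Real.norm_eq_abs, sub_zero] at this
    have h2 := abs_sub_abs_le_abs_sub (Real.log (Z x)) (Real.log (Z 0))
    linarith
  obtain ⟨hint, hval⟩ := integral_symExp_sub_deriv_two
    (K := |Real.log (Z 0)| + C + 2 * C ^ 2) dg dg' hcont
    (fun x => by
      have := hgrowth x
      have h1 : 0 ≤ |Real.log (Z 0)| * |x| := by positivity
      have h2 : 0 ≤ C ^ 2 * |x| := by positivity
      nlinarith [sq_nonneg C])
    (fun x => by
      have := hZ₁b x
      nlinarith [abs_nonneg (Real.log (Z 0)), sq_nonneg C])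
    (fun x => by
      have h1 := abs_sub (Z₂ x / Z x) ((Z₁ x / Z x) ^ 2)
      have h2 : |(Z₁ x / Z x) ^ 2| ≤ C ^ 2 := by
        rw [abs_pow]; exact pow_le_pow_left₀ (abs_nonneg _) (hZ₁b x) 2
      linarith [hZ₂b x, abs_nonneg (Real.log (Z 0))])
  refine ⟨_, hint, ?_, fun x => ?_⟩
  · rw [hval]; simp [hZ]
  · set p : ι → ℝ := fun i => w i * Real.exp (2 * u i * x) / Z x with hp
    have hp0 : ∀ i, 0 < p i := fun i => div_pos (hwe i x) (hZpos x)
    have hp1 : ∑ i ∈ S, p i = 1 := by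
      rw [hp, ← Finset.sum_div]; exact div_self (hZpos x).ne'
    obtain ⟨s, hs⟩ := exists_exp_neg_le_windowMass u hp0 hp1 (Z₁ x / Z x / 2)
    have hvar : 4 * ∑ i ∈ S, p i * (u i - Z₁ x / Z x / 2) ^ 2 =
        Z₂ x / Z x - (Z₁ x / Z x) ^ 2 := by
      have e1 : ∑ i ∈ S, p i * (2 * u i) = Z₁ x / Z x := by
        rw [hZ₁, Finset.sum_div]; exact Finset.sum_congr rfl fun i _ => by rw [hp]; ring
      have e2 : ∑ i ∈ S, p i * (2 * u i) ^ 2 = Z₂ x / Z x := by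
        rw [hZ₂, Finset.sum_div]; exact Finset.sum_congr rfl fun i _ => by rw [hp]; ring
      set r := Z₁ x / Z x
      calc 4 * ∑ i ∈ S, p i * (u i - r / 2) ^ 2
          = ∑ i ∈ S, (p i * (2 * u i) ^ 2 - 2 * r * (p i * (2 * u i)) + r ^ 2 * p i) := by
            rw [Finset.mul_sum]; exact Finset.sum_congr rfl fun i _ => by ring
        _ = _ := by
            rw [Finset.sum_add_distrib, Finset.sum_sub_distrib, ← Finset.mul_sum,
              ← Finset.mul_sum, e1, e2, hp1]
            ring
    rw [hvar] at hs
    have hmass : windowMass S p u s =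
        (∑ i ∈ S with s ≤ u i ∧ u i ≤ s + 1, w i * Real.exp (2 * u i * x)) / Z x := by
      rw [windowMass, hp, Finset.sum_div]
    have hpos : 0 < windowMass S p u s := (Real.exp_pos _).trans_le hs
    have hne : (S.filter fun i => s ≤ u i ∧ u i ≤ s + 1).Nonempty := by
      rw [Finset.nonempty_iff_ne_empty]
      intro h
      rw [windowMass, h, Finset.sum_empty] at hpos
      exact hpos.false
    refine ⟨s, hne, ?_⟩
    rw [← Real.le_log_iff_exp_le hpos, hmass,
      Real.log_div (Finset.sum_pos (fun i _ => hwe i x) hne).ne' (hZpos x).ne'] at hs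
    linarith

lemma integrable_eval_expVec {n : ℕ} (k : Fin n) : Integrable (fun e => e k) (expVec n) := by
  have h : Integrable (fun x : ℝ => x) symExp :=
    integrable_symExp (K := 1) continuous_id fun x => by simp
  exact integrable_comp_eval (μ := fun _ : Fin n => symExp) (i := k) h

lemma integrable_sum_mul_expVec {n : ℕ} (t : Fin n → ℝ) :
    Integrable (fun e => ∑ k, e k * t k) (expVec n) :=
  integrable_finsetSum _ fun k _ => (integrable_eval_expVec k).mul_const (t k)

lemma integrable_sup'_expVec {n : ℕ} {ι : Type*} {S : Finset ι} (hS : S.Nonempty)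
    (t : ι → Fin n → ℝ) (a : ι → ℝ) :
    Integrable (fun e => S.sup' hS fun i => ∑ k, e k * t i k + a i) (expVec n) := by
  refine (integrable_finsetSum S (f := fun i e => |∑ k, e k * t i k + a i|) fun i _ =>
    ((integrable_sum_mul_expVec (t i)).add (integrable_const (a i))).abs).mono'
    (Continuous.finset_sup'_apply hS fun i _ => by fun_prop).aestronglyMeasurable
    (ae_of_all _ fun e => ?_)
  obtain ⟨i, hi, h⟩ := Finset.exists_mem_eq_sup' hS fun i => ∑ k, e k * t i k + a i
  rw [h, Real.norm_eq_abs]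
  exact Finset.single_le_sum (f := fun i => |∑ k, e k * t i k + a i|)
    (fun j _ => abs_nonneg _) hi

/-- Sudakov minoration for the exponential process over a finite `1`-separated set, with weights. -/
lemma half_log_sum_exp_le_integral_sup' {ι : Type*} : ∀ (n : ℕ) (S : Finset ι) (hS : S.Nonempty)
    (t : ι → Fin n → ℝ) (a : ι → ℝ),
    (∀ i ∈ S, ∀ j ∈ S, i ≠ j → ∃ k, 1 < |t i k - t j k|) →
    1 / 2 * Real.log (∑ i ∈ S, Real.exp (2 * a i)) ≤
      ∫ e, (S.sup' hS fun i => ∑ k, e k * t i k + a i) ∂expVec n := by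
  intro n
  induction n with
  | zero =>
    intro S hS t a sep
    obtain ⟨i, hi⟩ := hS
    have hSi : S = {i} := by
      refine Finset.eq_singleton_iff_unique_mem.2 ⟨hi, fun j hj => ?_⟩
      by_contra h
      obtain ⟨k, -⟩ := sep j hj i hi h
      exact k.elim0
    subst hSi
    simp
  | succ n ih =>
    intro S hS t a sep
    obtain ⟨D, hD, hDval, hDle⟩ := exists_integrable_le_log_window hS
      (w := fun i => Real.exp (2 * a i)) (fun i => Real.exp_pos _) (fun i => t i 0)
    have hmp := (measurePreserving_piFinSuccAbove (fun _ : Fin (n + 1) => symExp) 0).symm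
    set F : (Fin (n + 1) → ℝ) → ℝ := fun e => S.sup' hS fun i => ∑ k, e k * t i k + a i with hF
    have hFint : Integrable F (expVec (n + 1)) := integrable_sup'_expVec hS t a
    have hFcons : ∀ x (y : Fin n → ℝ),
        F ((MeasurableEquiv.piFinSuccAbove (fun _ => ℝ) 0).symm (x, y)) =
          S.sup' hS fun i => ∑ k, y k * t i k.succ + (x * t i 0 + a i) := by
      intro x y
      simp only [hF]
      congr 1
      funext i
      rw [Fin.sum_univ_succ]
      simp [MeasurableEquiv.piFinSuccAbove]
      ring
    have hint2 : Integrable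
        (fun z : ℝ × (Fin n → ℝ) => F ((MeasurableEquiv.piFinSuccAbove (fun _ => ℝ) 0).symm z))
        (symExp.prod (expVec n)) :=
      (hmp.integrable_comp_emb (MeasurableEquiv.measurableEmbedding _)).2 hFint
    have heq : ∫ e, F e ∂expVec (n + 1) = ∫ x, ∫ y,
        F ((MeasurableEquiv.piFinSuccAbove (fun _ => ℝ) 0).symm (x, y)) ∂expVec n ∂symExp := by
      rw [← integral_prod _ hint2]
      exact (hmp.integral_comp (MeasurableEquiv.measurableEmbedding _) F).symm
    rw [heq, ← hDval, ← integral_const_mul]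
    refine integral_mono (hD.const_mul _) hint2.integral_prod_left fun x => ?_
    simp only [hFcons]
    obtain ⟨s, hne, hs⟩ := hDle x
    refine (mul_le_mul_of_nonneg_left hs (by norm_num)).trans ?_
    have h1 := ih (S.filter fun i => s ≤ t i 0 ∧ t i 0 ≤ s + 1) hne (fun i k => t i k.succ)
      (fun i => x * t i 0 + a i) (by
        intro i hi j hj hij
        rw [Finset.mem_filter] at hi hj
        obtain ⟨k, hk⟩ := sep i hi.1 j hj.1 hij
        refine Fin.cases (fun h => ?_) (fun k h => ⟨k, h⟩) k hk
        exact absurd h (not_lt.2 (abs_le.2 ⟨by linarith [hi.2.1, hj.2.2],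
          by linarith [hi.2.2, hj.2.1]⟩)))
    refine le_trans (le_of_eq ?_) (h1.trans (integral_mono (integrable_sup'_expVec _ _ _)
      (integrable_sup'_expVec _ _ _) fun y =>
        Finset.sup'_mono _ (Finset.filter_subset _ _) hne))
    congr 2
    refine Finset.sum_congr rfl fun i _ => ?_
    rw [← Real.exp_add]
    ring_nf

section Supremum

lemma sum_mul_le {n : ℕ} {C : ℝ} {t : Fin n → ℝ} (ht : ∀ i, |t i| ≤ C) (e : Fin n → ℝ) :
    |∑ i, e i * t i| ≤ C * ∑ i, |e i| := by
  rw [Finset.mul_sum]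
  refine (Finset.abs_sum_le_sum_abs _ _).trans (Finset.sum_le_sum fun i _ => ?_)
  rw [abs_mul, mul_comm]
  exact mul_le_mul_of_nonneg_right (ht i) (abs_nonneg _)

lemma bddAbove_range_sum_mul {n : ℕ} {κ : Type*} {C : ℝ} {v : κ → Fin n → ℝ}
    (hv : ∀ j i, |v j i| ≤ C) (e : Fin n → ℝ) :
    BddAbove (range fun j => ∑ i, e i * v j i) := by
  refine ⟨C * ∑ i, |e i|, ?_⟩
  rintro _ ⟨j, rfl⟩
  exact (le_abs_self _).trans (sum_mul_le (hv j) e)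

lemma integrable_iSup_expVec {n : ℕ} {κ : Type*} [Nonempty κ] {C : ℝ} {v : κ → Fin n → ℝ}
    (hv : ∀ j i, |v j i| ≤ C) :
    Integrable (fun e => ⨆ j, ∑ i, e i * v j i) (expVec n) := by
  have hcont : Continuous fun e : Fin n → ℝ => ⨆ j, ∑ i, e i * v j i := by
    refine (LipschitzWith.of_le_add_mul' (n * C) fun e e' => ciSup_le fun j => ?_).continuous
    have h1 := le_ciSup (bddAbove_range_sum_mul hv e') j
    have h2 := (le_abs_self _).trans (sum_mul_le (hv j) (e - e'))
    have h3 : ∑ i, |(e - e') i| ≤ n * dist e e' := by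
      refine (Finset.sum_le_card_nsmul _ _ (dist e e') fun i _ => dist_le_pi_dist e e' i).trans ?_
      simp
    have h4 : C * ∑ i, |(e - e') i| ≤ n * C * dist e e' := by
      rcases n.eq_zero_or_pos with rfl | hn
      · simp
      · have hC : 0 ≤ C := (abs_nonneg _).trans (hv j ⟨0, hn⟩)
        nlinarith
    simp only [Pi.sub_apply, sub_mul, Finset.sum_sub_distrib] at h2 h4
    linarith
  refine ((integrable_finsetSum Finset.univ fun i _ =>
    (integrable_eval_expVec i).abs).const_mul C).mono' hcont.aestronglyMeasurable
    (ae_of_all _ fun e => ?_)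
  rw [Real.norm_eq_abs, abs_le]
  obtain ⟨j⟩ := ‹Nonempty κ›
  exact ⟨(abs_le.1 (sum_mul_le (hv j) e)).1.trans (le_ciSup (bddAbove_range_sum_mul hv e) j),
    ciSup_le fun j => (le_abs_self _).trans (sum_mul_le (hv j) e)⟩

/-- Sudakov minoration for the exponential process: a lower bound by an `r`-separated set. -/
lemma half_mul_log_card_le {n : ℕ} {T : Set (Fin n → ℝ)} (hT : Bornology.IsBounded T) {r : ℝ}
    (hr : 0 < r) {S : Finset (Fin n → ℝ)} (hS : S.Nonempty) (hST : ∀ t ∈ S, t ∈ T)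
    (sep : ∀ s ∈ S, ∀ t ∈ S, s ≠ t → ∃ k, r < |s k - t k|) :
    r / 2 * Real.log S.card ≤ ∫ e, (⨆ t' ∈ T, ∑ i, e i * t' i) ∂expVec n := by
  classical
  obtain ⟨C, hC0, hC⟩ := hT.exists_pos_norm_le
  set v : (Fin n → ℝ) → Fin n → ℝ := fun t => if t ∈ T then t else 0 with hv
  have hvC : ∀ t i, |v t i| ≤ C := fun t i => by
    by_cases h : t ∈ T
    · simpa [hv, h] using (norm_le_pi_norm t i).trans (hC t h)
    · simpa [hv, h] using hC0.le
  have hsup : ∀ e : Fin n → ℝ, (⨆ t' ∈ T, ∑ i, e i * t' i) = ⨆ t, ∑ i, e i * v t i := fun e => by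
    refine iSup_congr fun t => ?_
    by_cases h : t ∈ T <;> simp [hv, h]
  simp only [hsup]
  have h1 := half_log_sum_exp_le_integral_sup' n S hS (fun t k => t k / r) (fun _ => 0)
    (fun s hs t ht hst => by
      obtain ⟨k, hk⟩ := sep s hs t ht hst
      refine ⟨k, ?_⟩
      rwa [← sub_div, abs_div, abs_of_pos hr, one_lt_div hr])
  have h2 : ∫ e, (S.sup' hS fun t => ∑ k, e k * (t k / r) + 0) ∂expVec n ≤
      ∫ e, (⨆ t, ∑ i, e i * v t i) / r ∂expVec n := by
    refine integral_mono (integrable_sup'_expVec hS (fun t k => t k / r) _)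
      ((integrable_iSup_expVec hvC).div_const r) fun e => Finset.sup'_le _ _ fun t ht => ?_
    have h3 := le_ciSup (bddAbove_range_sum_mul hvC e) t
    simp only [hv, if_pos (hST t ht)] at h3
    simp only [add_zero, ← mul_div_assoc, ← Finset.sum_div]
    exact div_le_div_of_nonneg_right h3 hr.le
  rw [integral_div] at h2
  simp only [mul_zero, Real.exp_zero, Finset.sum_const, nsmul_eq_mul, mul_one] at h1
  have h3 := h1.trans h2
  rw [le_div_iff₀ hr] at h3
  linarith

/-- A maximal separated subset of `T` is a net, provided separated subsets have bounded size. -/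
lemma exists_net_of_card_le {n : ℕ} {T : Set (Fin n → ℝ)} {r : ℝ} (hr : 0 ≤ r) {M : ℝ}
    (hM : ∀ S : Finset (Fin n → ℝ), (∀ t ∈ S, t ∈ T) →
      (∀ s ∈ S, ∀ t ∈ S, s ≠ t → ∃ k, r < |s k - t k|) → (S.card : ℝ) ≤ M) :
    ∃ c : Finset (Fin n → ℝ), (c.card : ℝ) ≤ M ∧
      ∀ t ∈ T, ∃ s ∈ c, (⨆ i, |t i - s i|) ≤ r := by
  classical
  set p : ℕ → Prop := fun k => ∃ S : Finset (Fin n → ℝ), S.card = k ∧ (∀ t ∈ S, t ∈ T) ∧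
    ∀ s ∈ S, ∀ t ∈ S, s ≠ t → ∃ k, r < |s k - t k| with hp
  have hp0 : p 0 := ⟨∅, by simp⟩
  obtain ⟨S, hcard, hST, sep⟩ := Nat.findGreatest_spec (P := p) (Nat.zero_le ⌊M⌋₊) hp0
  refine ⟨S, hM S hST sep, fun t ht => ?_⟩
  by_contra! hfar
  have hfar' : ∀ s ∈ S, ∃ k, r < |t k - s k| := fun s hs => by
    by_contra! h
    exact (hfar s hs).not_ge (Real.iSup_le h hr)
  have htS : t ∉ S := fun h => by
    obtain ⟨k, hk⟩ := hfar' t h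
    simp only [sub_self, abs_zero] at hk
    linarith
  have hT' : ∀ s ∈ insert t S, s ∈ T := by
    intro s hs
    rcases Finset.mem_insert.1 hs with rfl | hs
    exacts [ht, hST s hs]
  have sep' : ∀ s ∈ insert t S, ∀ u ∈ insert t S, s ≠ u → ∃ k, r < |s k - u k| := by
    intro s hs u hu hsu
    rcases Finset.mem_insert.1 hs with rfl | hsS <;>
      rcases Finset.mem_insert.1 hu with rfl | huS
    · exact absurd rfl hsu
    · exact hfar' u huS
    · obtain ⟨k, hk⟩ := hfar' s hsS
      exact ⟨k, by rwa [abs_sub_comm]⟩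
    · exact sep s hsS u huS hsu
  have hc := Finset.card_insert_of_notMem htS
  have h1 : S.card + 1 ≤ ⌊M⌋₊ := hc ▸ Nat.le_floor (hM _ hT' sep')
  have h2 : S.card + 1 ≤ Nat.findGreatest p ⌊M⌋₊ :=
    Nat.le_findGreatest h1 ⟨_, hc, hT', sep'⟩
  omega

end Supremum

/-- Sudakov-type minoration for the exponential process, in the `ℓ_∞` metric:
`N(T, d_∞, ε·E sup_{t∈T} ∑ᵢ ℰᵢ tᵢ) ≤ e^{4/ε}`; a covering by closed balls of diameter `δ`
is witnessed by centers at `d_∞`-distance at most `δ/2`. -/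
theorem statement_16 :
    ∀ (n : ℕ) (T : Set (Fin n → ℝ)), T.Nonempty → Bornology.IsBounded T →
    ∀ ε : ℝ, 0 < ε →
    ∃ c : Finset (Fin n → ℝ),
      (c.card : ℝ) ≤ Real.exp (4 / ε) ∧
      ∀ t ∈ T, ∃ s ∈ c, (⨆ i, |t i - s i|)
        ≤ ε * (∫ e, (⨆ t' ∈ T, ∑ i, e i * t' i) ∂expVec n) / 2 := by
  intro n T hne hT ε hε
  classical
  set b := ∫ e, (⨆ t' ∈ T, ∑ i, e i * t' i) ∂expVec n with hb
  have hb0 : 0 ≤ b := by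
    obtain ⟨t, ht⟩ := hne
    have := half_mul_log_card_le hT one_pos (S := {t}) (by simp) (by simpa using ht)
      (by simp +contextual)
    simpa using this
  have hexp : 1 ≤ Real.exp (4 / ε) := Real.one_le_exp (by positivity)
  refine exists_net_of_card_le (by positivity) fun S hST sep => ?_
  rcases le_or_gt S.card 1 with hcard | hcard
  · exact le_trans (by exact_mod_cast hcard) hexp
  have hS : S.Nonempty := Finset.card_pos.1 (by omega)
  have hlog : 0 < Real.log S.card := Real.log_pos (by exact_mod_cast hcard)
  rcases hb0.eq_or_lt with h0 | hbpos
  · obtain ⟨s, hs, t, ht, hst⟩ := Finset.one_lt_card.1 hcard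
    obtain ⟨k, hk⟩ := sep s hs t ht hst
    rw [← h0] at hk
    simp only [mul_zero, zero_div] at hk
    have := half_mul_log_card_le hT (half_pos hk) (S := {s, t}) (by simp)
      (by simpa using ⟨hST s hs, hST t ht⟩) (by
        intro x hx y hy hxy
        refine ⟨k, ?_⟩
        simp only [Finset.mem_insert, Finset.mem_singleton] at hx hy
        rcases hx with rfl | rfl <;> rcases hy with rfl | rfl
        · exact absurd rfl hxy
        · exact half_lt_self hk
        · rw [abs_sub_comm] at hk ⊢; exact half_lt_self hk
        · exact absurd rfl hxy)
    rw [Finset.card_pair hst, ← hb, ← h0] at this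
    have h2 : 0 < Real.log ((2 : ℕ) : ℝ) := Real.log_pos (by norm_num)
    have h3 : 0 < |s k - t k| / 2 / 2 * Real.log ((2 : ℕ) : ℝ) := by positivity
    linarith
  · have h1 := half_mul_log_card_le hT (by positivity) hS hST sep
    rw [← hb] at h1
    rw [← Real.log_le_iff_le_exp (by exact_mod_cast hS.card_pos), le_div_iff₀ hε]
    have h2 : b * (Real.log S.card * ε) ≤ b * 4 := by linarith
    exact le_of_mul_le_mul_left h2 hbpos

end Stmt16
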